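/- Let F be a field of characteristic zero, V a finite-dimensional F-vector space, and N a nilpotent endomorphism of V. Then there exists a weight filtration for N: a family (W_k)_{k ∈ ℤ} of subspaces of V with W_k ⊆ W_{k+1} for all k, W_k = 0 for all sufficiently small k, W_k = V for all sufficiently large k, such that (1) N(W_k) ⊆ W_{k-2} for all k ∈ ℤ, and (2) for each integer k ≥ 0, N^k maps W_k into W_{-k} and the induced map on quotients W_k/W_{k-1} → W_{-k}/W_{-k-1} is an isomorphism. -/

import Mathlib

/-- `W` is a weight filtration for the nilpotent endomorphism `N` of `V`:
an increasing filtration, exhaustive and separated, with `N (W k) ⊆ W (k-2)`,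
and such that for every natural number `k`, `N^k` maps `W k` into `W (-k)` and
the induced map `W k / W (k-1) → W (-k) / W (-k-1)` is an isomorphism
(expressed via injectivity and surjectivity of the induced map). -/
def IsWeightFiltration (F : Type*) [Field F] {V : Type*} [AddCommGroup V] [Module F V]
    (N : V →ₗ[F] V) (W : ℤ → Submodule F V) : Prop :=
  (∀ k : ℤ, W k ≤ W (k + 1)) ∧
  (∃ a : ℤ, ∀ k : ℤ, k ≤ a → W k = ⊥) ∧
  (∃ b : ℤ, ∀ k : ℤ, b ≤ k → W k = ⊤) ∧
  (∀ k : ℤ, ∀ x : V, x ∈ W k → N x ∈ W (k - 2)) ∧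
  (∀ j : ℕ,
    (∀ x : V, x ∈ W (j : ℤ) → (N ^ j) x ∈ W (-(j : ℤ))) ∧
    (∀ x : V, x ∈ W (j : ℤ) → (N ^ j) x ∈ W (-(j : ℤ) - 1) → x ∈ W ((j : ℤ) - 1)) ∧
    (∀ y : V, y ∈ W (-(j : ℤ)) → ∃ x ∈ W (j : ℤ), y - (N ^ j) x ∈ W (-(j : ℤ) - 1)))

theorem wf_step {F : Type*} [Field F] {V : Type*} [AddCommGroup V] [Module F V]
    (N : V →ₗ[F] V) (d : ℕ) (hN : N ^ (d + 2) = 0) (U : ℤ → Submodule F V)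
    (hmono : ∀ k, U k ≤ U (k + 1))
    (htop : ∀ k : ℤ, (d : ℤ) ≤ k → U k = LinearMap.ker (N ^ (d + 1)))
    (hbot : ∀ k : ℤ, k ≤ -(d : ℤ) - 1 → U k = LinearMap.range (N ^ (d + 1)))
    (hUN : ∀ k : ℤ, ∀ x, x ∈ U k → N x ∈ U (k - 2))
    (h1 : ∀ j : ℕ, ∀ x, x ∈ U (j : ℤ) → (N ^ j) x ∈ U (-(j : ℤ)))
    (h2 : ∀ j : ℕ, ∀ x, x ∈ U (j : ℤ) → (N ^ j) x ∈ U (-(j : ℤ) - 1) → x ∈ U ((j : ℤ) - 1))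
    (h3 : ∀ j : ℕ, ∀ y, y ∈ U (-(j : ℤ)) → ∃ x ∈ U (j : ℤ), y - (N ^ j) x ∈ U (-(j : ℤ) - 1)) :
    ∃ W : ℤ → Submodule F V, IsWeightFiltration F N W ∧
      (∀ k : ℤ, ((d + 1 : ℕ) : ℤ) ≤ k → W k = ⊤) ∧
      (∀ k : ℤ, k ≤ -((d + 1 : ℕ) : ℤ) - 1 → W k = ⊥) := by
  have hz : ∀ x, N ((N ^ (d + 1)) x) = 0 := fun x => by
    have := LinearMap.congr_fun hN x
    rwa [pow_succ'] at this
  have hz' : ∀ x, (N ^ (d + 1)) (N x) = 0 := fun x => by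
    have := LinearMap.congr_fun hN x
    rwa [pow_succ] at this
  let W : ℤ → Submodule F V := fun k =>
    if (d : ℤ) + 1 ≤ k then ⊤ else if k ≤ -(d : ℤ) - 2 then ⊥ else U k
  have Wt : ∀ k : ℤ, (d : ℤ) + 1 ≤ k → W k = ⊤ := fun k h => by simp only [W]; rw [if_pos h]
  have Wb : ∀ k : ℤ, k ≤ -(d : ℤ) - 2 → W k = ⊥ := fun k h => by
    simp only [W]; rw [if_neg (by omega), if_pos h]
  have Wu : ∀ k : ℤ, k ≤ d → -(d : ℤ) - 1 ≤ k → W k = U k := fun k h h' => by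
    simp only [W]; rw [if_neg (by omega), if_neg (by omega)]
  have NU : ∀ x, N x ∈ U ((d : ℤ) - 1) := fun x => by
    apply h2 d
    · rw [htop _ le_rfl]; exact hz' x
    · rw [hbot _ le_rfl]; exact ⟨x, by rw [pow_succ]; rfl⟩
  have NU' : ∀ x ∈ U (-(d : ℤ)), N x = 0 := fun x hx => by
    obtain ⟨y, hy, hxy⟩ := h3 d x hx
    rw [hbot _ le_rfl] at hxy
    rw [htop _ le_rfl] at hy
    obtain ⟨z, hz1⟩ := hxy
    have e : x = (N ^ (d + 1)) z + (N ^ d) y := by rw [hz1]; abel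
    rw [e, map_add, hz, zero_add]
    have : (N ^ (d + 1)) y = 0 := hy
    rwa [pow_succ'] at this
  refine ⟨W, ⟨?_, ⟨-(d : ℤ) - 2, Wb⟩, ⟨(d : ℤ) + 1, Wt⟩, ?_, ?_⟩, ?_, ?_⟩
  · intro k
    by_cases a : (d : ℤ) + 1 ≤ k + 1
    · rw [Wt _ a]; exact le_top
    by_cases b : k ≤ -(d : ℤ) - 2
    · rw [Wb _ b]; exact bot_le
    rw [Wu k (by omega) (by omega), Wu (k + 1) (by omega) (by omega)]
    exact hmono k
  · intro k x hx
    by_cases a : (d : ℤ) + 3 ≤ k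
    · rw [Wt _ (by omega)]; trivial
    by_cases b : k = (d : ℤ) + 2
    · subst b
      rw [Wu _ (by omega) (by omega), htop _ (by omega)]; exact hz' x
    by_cases b : k = (d : ℤ) + 1
    · subst b
      rw [Wu _ (by omega) (by omega)]
      convert NU x using 2
      ring
    by_cases c : k ≤ -(d : ℤ) - 2
    · rw [Wb _ c, Submodule.mem_bot] at hx
      rw [hx, map_zero]; exact zero_mem _
    rw [Wu k (by omega) (by omega)] at hx
    by_cases c : -(d : ℤ) + 1 ≤ k
    · rw [Wu _ (by omega) (by omega)]; exact hUN k x hx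
    have : N x = 0 := by
      apply NU'
      by_cases c : k = -(d : ℤ)
      · rwa [c] at hx
      · have : k = -(d : ℤ) - 1 := by omega
        subst this
        have := hmono _ hx
        simpa using this
    rw [this]; exact zero_mem _
  · intro j
    by_cases a : d + 2 ≤ j
    · have hj : N ^ j = 0 := pow_eq_zero_of_le a hN
      refine ⟨?_, ?_, ?_⟩
      · intro x _; rw [hj]; exact zero_mem _
      · intro x _ _; rw [Wt _ (by omega)]; trivial
      · intro y hy
        rw [Wb _ (by omega), Submodule.mem_bot] at hy
        exact ⟨0, zero_mem _, by rw [hy]; simp⟩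
    by_cases b : j = d + 1
    · subst b
      refine ⟨?_, ?_, ?_⟩
      · intro x _
        rw [Wu _ (by omega) (by omega), hbot _ (by omega)]; exact ⟨x, rfl⟩
      · intro x _ h
        rw [Wb _ (by omega), Submodule.mem_bot] at h
        rw [Wu _ (by omega) (by omega), htop _ (by omega)]; exact h
      · intro y hy
        rw [Wu _ (by omega) (by omega), hbot _ (by omega)] at hy
        obtain ⟨x, rfl⟩ := hy
        exact ⟨x, by rw [Wt _ (by omega)]; trivial, by simp⟩
    rw [Wu j (by omega) (by omega), Wu (-j) (by omega) (by omega),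
      Wu (j - 1) (by omega) (by omega), Wu (-j - 1) (by omega) (by omega)]
    exact ⟨h1 j, h2 j, h3 j⟩
  · intro k hk; exact Wt k (by omega)
  · intro k hk; exact Wb k (by omega)

theorem wf_main {F : Type*} [Field F] (d : ℕ) : ∀ {V : Type*} [AddCommGroup V] [Module F V]
    (N : V →ₗ[F] V) (_ : N ^ (d + 1) = 0),
    ∃ W : ℤ → Submodule F V, IsWeightFiltration F N W ∧
      (∀ k : ℤ, (d : ℤ) ≤ k → W k = ⊤) ∧ (∀ k : ℤ, k ≤ -(d : ℤ) - 1 → W k = ⊥) := by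
  induction d with
  | zero =>
    intro V _ _ N hN
    have hN : N = 0 := by simpa using hN
    subst hN
    let W : ℤ → Submodule F V := fun k => if 0 ≤ k then ⊤ else ⊥
    have Wt : ∀ k : ℤ, 0 ≤ k → W k = ⊤ := fun k h => by simp only [W]; rw [if_pos h]
    have Wb : ∀ k : ℤ, k ≤ -1 → W k = ⊥ := fun k h => by simp only [W]; rw [if_neg (by omega)]
    refine ⟨W, ⟨?_, ⟨-1, Wb⟩, ⟨0, Wt⟩, ?_, ?_⟩, ?_, ?_⟩
    · intro k
      by_cases h : 0 ≤ k
      · rw [Wt (k + 1) (by omega)]; exact le_top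
      · rw [Wb k (by omega)]; exact bot_le
    · intro k x _; exact zero_mem _
    · intro j
      by_cases hj : j = 0
      · subst hj
        refine ⟨fun x hx => by simpa using hx, fun x _ h => by simpa using h, fun y hy => ⟨y, by simpa using hy, by simp⟩⟩
      · rw [zero_pow hj]
        refine ⟨fun x _ => zero_mem _, fun x _ _ => by rw [Wt _ (by omega)]; trivial, ?_⟩
        intro y hy
        rw [Wb _ (by omega), Submodule.mem_bot] at hy
        exact ⟨0, zero_mem _, by rw [hy]; simp⟩
    · intro k hk; exact Wt k (by simpa using hk)
    · intro k hk; exact Wb k (by simpa using hk)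
  | succ d ih =>
    intro V _ _ N hN
    have hz : ∀ x, N ((N ^ (d + 1)) x) = 0 := fun x => by
      have := LinearMap.congr_fun hN x
      rwa [pow_succ'] at this
    have hz' : ∀ x, (N ^ (d + 1)) (N x) = 0 := fun x => by
      have := LinearMap.congr_fun hN x
      rwa [pow_succ] at this
    let K := LinearMap.ker (N ^ (d + 1))
    let I := LinearMap.range (N ^ (d + 1))
    have hIK : I ≤ K := by
      rintro _ ⟨x, rfl⟩
      change (N ^ (d + 1)) ((N ^ (d + 1)) x) = 0
      rw [pow_succ (N) d, Module.End.mul_apply, ← pow_succ, hz, map_zero]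
    let NK : K →ₗ[F] K := N.restrict (p := K) (q := K) (fun x _ => hz' x)
    let J : Submodule F K := I.comap K.subtype
    have hJ : J ≤ J.comap NK := by
      rintro ⟨x, hx⟩ ⟨y, hy⟩
      refine ⟨0, ?_⟩
      change _ = N x
      have : (N ^ (d + 1)) y = x := hy
      rw [← this, hz, map_zero]
    let Q := J.mapQ J NK hJ
    have hpow : ∀ (j : ℕ) (x : K), ∃ h : (N ^ j) x ∈ K, (Q ^ j) (J.mkQ x) = J.mkQ ⟨(N ^ j) x, h⟩ := by
      intro j
      induction j with
      | zero => intro x; exact ⟨x.2, rfl⟩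
      | succ j ihj =>
        intro x
        obtain ⟨h, e⟩ := ihj x
        refine ⟨by rw [pow_succ']; exact hz' _, ?_⟩
        rw [pow_succ', Module.End.mul_apply, e]
        change J.mkQ (NK _) = _
        congr 1
        apply Subtype.ext
        change N ((N ^ j) x) = (N ^ (j + 1)) x
        rw [pow_succ']
        rfl
    have hQ : Q ^ (d + 1) = 0 := by
      ext x
      obtain ⟨h, e⟩ := hpow (d + 1) x
      change (Q ^ (d + 1)) (J.mkQ x) = 0
      rw [e]
      have : (⟨(N ^ (d + 1)) x, h⟩ : K) = 0 := Subtype.ext x.2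
      rw [this, map_zero]
    obtain ⟨W, ⟨w1, -, -, w4, w5⟩, wt, wb⟩ := ih Q hQ
    let U : ℤ → Submodule F V := fun k => ((W k).comap J.mkQ).map K.subtype
    have hU : ∀ k x, x ∈ U k ↔ ∃ h : x ∈ K, J.mkQ ⟨x, h⟩ ∈ W k := by
      intro k x
      simp only [U, Submodule.mem_map, Submodule.mem_comap]
      constructor
      · rintro ⟨y, hy, rfl⟩; exact ⟨y.2, hy⟩
      · rintro ⟨h, hy⟩; exact ⟨⟨x, h⟩, hy, rfl⟩
    refine wf_step N d hN U ?_ ?_ ?_ ?_ ?_ ?_ ?_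
    · intro k; exact Submodule.map_mono (Submodule.comap_mono (w1 k))
    · intro k hk
      ext x
      rw [hU, wt k hk]
      exact ⟨fun h => h.1, fun h => ⟨h, trivial⟩⟩
    · intro k hk
      ext x
      rw [hU, wb k hk]
      simp only [Submodule.mem_bot, Submodule.mkQ_apply, Submodule.Quotient.mk_eq_zero]
      exact ⟨fun h => h.2, fun h => ⟨hIK h, h⟩⟩
    · intro k x hx
      rw [hU] at hx ⊢
      obtain ⟨h, hx⟩ := hx
      exact ⟨hz' x, w4 k _ hx⟩
    · intro j x hx
      rw [hU] at hx ⊢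
      obtain ⟨h, hx⟩ := hx
      obtain ⟨h', e⟩ := hpow j ⟨x, h⟩
      exact ⟨h', e ▸ (w5 j).1 _ hx⟩
    · intro j x hx hx'
      rw [hU] at hx hx' ⊢
      obtain ⟨h, hx⟩ := hx
      obtain ⟨h1, hx'⟩ := hx'
      obtain ⟨h', e⟩ := hpow j ⟨x, h⟩
      exact ⟨h, (w5 j).2.1 _ hx (by rw [e]; exact hx')⟩
    · intro j y hy
      rw [hU] at hy
      obtain ⟨h, hy⟩ := hy
      obtain ⟨q, hq, hqy⟩ := (w5 j).2.2 _ hy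
      obtain ⟨x, rfl⟩ := J.mkQ_surjective q
      obtain ⟨h', e⟩ := hpow j x
      refine ⟨x, (hU _ _).2 ⟨x.2, hq⟩, (hU _ _).2 ⟨K.sub_mem h h', ?_⟩⟩
      rw [e, ← map_sub] at hqy
      exact hqy

/-- The weight filtration of a nilpotent endomorphism of a finite-dimensional vector
space over a field of characteristic zero exists. -/
theorem exists_weightFiltration (F : Type*) [Field F] [CharZero F]
    (V : Type*) [AddCommGroup V] [Module F V] [FiniteDimensional F V]
    (N : V →ₗ[F] V) (hN : IsNilpotent N) :
    ∃ W : ℤ → Submodule F V, IsWeightFiltration F N W := by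
  obtain ⟨n, hn⟩ := hN
  obtain ⟨W, hW, -⟩ := wf_main n N (pow_eq_zero_of_le (Nat.le_succ n) hn)
  exact ⟨W, hW⟩
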